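/- arXiv:2503.11912 — 14 statements merged into one kernel-verified Lean document; each statement's English description precedes it below -/
import Mathlib

section
/- Let ε = 1 or ε = −1, b ∈ ℝ with εb > 0, a, ϱ ∈ ℂ with 0 < Re ϱ < 1, ϱ + ia/2 ∉ ℤ and ϱ − ia/2 ∉ ℤ, and suppose the monodromy data (a, s₀⁰, s₀^∞, s₁^∞, g₁₁, g₁₂, g₂₁, g₂₂) satisfy the monodromy manifold equations together with cos(2πϱ) = −i·s₀⁰/2. Define (with all complex powers principal and Γ the complex Gamma function): w₁ = ((εb/2)·e^{iπ/2})^{1/2−ϱ}·(Γ(2ϱ)/Γ(2−2ϱ))·Γ(1−ϱ+ia/2)·(g₁₁e^{iπ/4}e^{−iπϱ} + g₂₁e^{−iπ/4}e^{iπϱ}); w₂ = ((εb/2)·e^{iπ/2})^{ϱ−1/2}·(Γ(2−2ϱ)/Γ(2ϱ))·Γ(ϱ+ia/2)·(g₁₁e^{iπ/4}e^{iπϱ} + g₂₁e^{−iπ/4}e^{−iπϱ}); w₃ = ((εb/2)·e^{−iπ/2})^{1/2−ϱ}·(Γ(2ϱ)/Γ(2−2ϱ))·Γ(1−ϱ−ia/2)·(g₁₂e^{iπ/4}e^{−iπϱ}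 + g₂₂e^{−iπ/4}e^{iπϱ}); w₄ = ((εb/2)·e^{−iπ/2})^{ϱ−1/2}·(Γ(2−2ϱ)/Γ(2ϱ))·Γ(ϱ−ia/2)·(g₁₂e^{iπ/4}e^{iπϱ} + g₂₂e^{−iπ/4}e^{−iπϱ}). Then w₁·w₂·w₃·w₄ = (2π)²·e^{−πa} and w₁·w₄ = w₂·w₃. -/
open Complex Real

/-- Principal power of `c * exp (i t)` for `c > 0` and `t ∈ (-π, π]`. -/
theorem ofReal_mul_exp_cpow {c t : ℝ} (hc : 0 < c) (h1 : -π < t) (h2 : t ≤ π) (z : ℂ) :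
    ((c : ℂ) * Complex.exp (t * I)) ^ z = Complex.exp ((Real.log c + t * I) * z) := by
  have hX : (c : ℂ) * Complex.exp (t * I) = Complex.exp (Real.log c + t * I) := by
    rw [Complex.exp_add, ← Complex.ofReal_exp, Real.exp_log hc]
  rw [hX, Complex.cpow_def_of_ne_zero (Complex.exp_ne_zero _), Complex.log_exp]
  · simpa using h1
  · simpa using h2

/-- Reflection formula for `Γ` written through `exp (iπz)`. -/
theorem Gamma_one_sub_mul_Gamma_mul {z : ℂ} (hz : ∀ k : ℤ, z ≠ k) :
    Complex.Gamma (1 - z) * Complex.Gamma z *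
      (Complex.exp (I * π * z) ^ 2 - 1) = 2 * π * I * Complex.exp (I * π * z) := by
  have hs := sin_pi_mul_ne_zero fun ⟨k, hk⟩ => hz k hk.symm
  have hv := Complex.exp_ne_zero (I * π * z)
  have hsin : Complex.exp (I * π * z) ^ 2 - 1 =
      2 * I * Complex.exp (I * π * z) * Complex.sin (π * z) := by
    rw [Complex.sin, show -(π * z) * I = -(I * π * z) by ring,
      show π * z * I = I * π * z by ring, Complex.exp_neg]
    field_simp
    linear_combination (Complex.exp (I * π * z) ^ 2 - 1) * Complex.I_sq
  rw [mul_comm (Complex.Gamma _), Complex.Gamma_mul_Gamma_one_sub, hsin]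
  field_simp

/-- Proposition 3.1: identities for the coefficients `w₁, w₂, w₃, w₄` parametrizing the
small-`τ` asymptotics of the degenerate third Painlevé transcendent in terms of the
monodromy data. -/
theorem w_identities
    (ε b : ℝ) (hε : ε = 1 ∨ ε = -1) (hεb : ε * b > 0)
    (a ϱ s00 s0inf s1inf g11 g12 g21 g22 : ℂ)
    (hϱ0 : 0 < ϱ.re) (hϱ1 : ϱ.re < 1)
    (hϱa1 : ∀ k : ℤ, ϱ + I * a / 2 ≠ (k : ℂ))
    (hϱa2 : ∀ k : ℤ, ϱ - I * a / 2 ≠ (k : ℂ))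
    (h1 : s0inf * s1inf =
      -1 - Complex.exp (-(2 * (π : ℂ)) * a) - I * s00 * Complex.exp (-(π : ℂ) * a))
    (h2 : g21 * g22 - g11 * g12 + s00 * g11 * g22 = I * Complex.exp (-(π : ℂ) * a))
    (h3 : g11 ^ 2 - g21 ^ 2 - s00 * g11 * g21 = I * s0inf * Complex.exp (-(π : ℂ) * a))
    (h4 : g22 ^ 2 - g12 ^ 2 + s00 * g12 * g22 = I * s1inf * Complex.exp ((π : ℂ) * a))
    (h5 : g11 * g22 - g12 * g21 = 1)
    (hcos : Complex.cos (2 * (π : ℂ) * ϱ) = -I * s00 / 2)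
    (w₁ w₂ w₃ w₄ : ℂ)
    (hw₁ : w₁ = (((ε * b : ℝ) : ℂ) / 2 * Complex.exp (I * (π : ℂ) / 2)) ^ ((1 : ℂ) / 2 - ϱ) *
      (Complex.Gamma (2 * ϱ) / Complex.Gamma (2 - 2 * ϱ)) *
      Complex.Gamma (1 - ϱ + I * a / 2) *
      (g11 * Complex.exp (I * (π : ℂ) / 4) * Complex.exp (-(I * (π : ℂ) * ϱ)) +
        g21 * Complex.exp (-(I * (π : ℂ) / 4)) * Complex.exp (I * (π : ℂ) * ϱ)))
    (hw₂ : w₂ = (((ε * b : ℝ) : ℂ) / 2 * Complex.exp (I * (π : ℂ) / 2)) ^ (ϱ - (1 : ℂ) / 2) *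
      (Complex.Gamma (2 - 2 * ϱ) / Complex.Gamma (2 * ϱ)) *
      Complex.Gamma (ϱ + I * a / 2) *
      (g11 * Complex.exp (I * (π : ℂ) / 4) * Complex.exp (I * (π : ℂ) * ϱ) +
        g21 * Complex.exp (-(I * (π : ℂ) / 4)) * Complex.exp (-(I * (π : ℂ) * ϱ))))
    (hw₃ : w₃ = (((ε * b : ℝ) : ℂ) / 2 * Complex.exp (-(I * (π : ℂ) / 2))) ^ ((1 : ℂ) / 2 - ϱ) *
      (Complex.Gamma (2 * ϱ) / Complex.Gamma (2 - 2 * ϱ)) *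
      Complex.Gamma (1 - ϱ - I * a / 2) *
      (g12 * Complex.exp (I * (π : ℂ) / 4) * Complex.exp (-(I * (π : ℂ) * ϱ)) +
        g22 * Complex.exp (-(I * (π : ℂ) / 4)) * Complex.exp (I * (π : ℂ) * ϱ)))
    (hw₄ : w₄ = (((ε * b : ℝ) : ℂ) / 2 * Complex.exp (-(I * (π : ℂ) / 2))) ^ (ϱ - (1 : ℂ) / 2) *
      (Complex.Gamma (2 - 2 * ϱ) / Complex.Gamma (2 * ϱ)) *
      Complex.Gamma (ϱ - I * a / 2) *
      (g12 * Complex.exp (I * (π : ℂ) / 4) * Complex.exp (I * (π : ℂ) * ϱ) +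
        g22 * Complex.exp (-(I * (π : ℂ) / 4)) * Complex.exp (-(I * (π : ℂ) * ϱ)))) :
    w₁ * w₂ * w₃ * w₄ = (2 * (π : ℂ)) ^ 2 * Complex.exp (-(π : ℂ) * a) ∧
    w₁ * w₄ = w₂ * w₃ := by
  have hG1 : Complex.Gamma (2 * ϱ) ≠ 0 := Complex.Gamma_ne_zero_of_re_pos (by simpa using hϱ0)
  have hG2 : Complex.Gamma (2 - 2 * ϱ) ≠ 0 :=
    Complex.Gamma_ne_zero_of_re_pos (by simp; linarith)
  have hc : 0 < ε * b / 2 := by linarith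
  have hpow1 : ∀ z : ℂ, (((ε * b : ℝ) : ℂ) / 2 * Complex.exp (I * (π : ℂ) / 2)) ^ z =
      Complex.exp ((Real.log (ε * b / 2) + I * π / 2) * z) := by
    intro z
    have := ofReal_mul_exp_cpow (t := π / 2) hc (by linarith [Real.pi_pos])
      (by linarith [Real.pi_pos]) z
    convert this using 3 <;> push_cast <;> ring_nf
  have hpow2 : ∀ z : ℂ, (((ε * b : ℝ) : ℂ) / 2 * Complex.exp (-(I * (π : ℂ) / 2))) ^ z =
      Complex.exp ((Real.log (ε * b / 2) - I * π / 2) * z) := by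
    intro z
    have := ofReal_mul_exp_cpow (t := -(π / 2)) hc (by linarith [Real.pi_pos])
      (by linarith [Real.pi_pos]) z
    convert this using 3 <;> push_cast <;> ring_nf
  rw [hpow1] at hw₁ hw₂
  rw [hpow2] at hw₃ hw₄
  have hR1 := Gamma_one_sub_mul_Gamma_mul hϱa2
  have hR2 := Gamma_one_sub_mul_Gamma_mul hϱa1
  rw [show 1 - (ϱ - I * a / 2) = 1 - ϱ + I * a / 2 by ring] at hR1
  rw [show 1 - (ϱ + I * a / 2) = 1 - ϱ - I * a / 2 by ring] at hR2
  set u := Complex.exp (I * π * ϱ) with hu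
  set h := Complex.exp (-(π * a / 2)) with hh
  set q := Complex.exp (I * π / 4) with hq
  have hu0 : u ≠ 0 := Complex.exp_ne_zero _
  have hh0 : h ≠ 0 := Complex.exp_ne_zero _
  have hq0 : q ≠ 0 := Complex.exp_ne_zero _
  have hE : Complex.exp (-π * a) = h ^ 2 := by
    rw [hh, ← Complex.exp_nat_mul]; congr 1; push_cast; ring
  have hqq : q ^ 2 = I := by
    rw [hq, ← Complex.exp_nat_mul]
    refine Eq.trans ?_ Complex.exp_pi_div_two_mul_I
    congr 1; push_cast; ring
  have hv1 : Complex.exp (I * π * (ϱ - I * a / 2)) = u * h⁻¹ := by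
    rw [hu, hh, ← Complex.exp_neg, ← Complex.exp_add]; congr 1
    linear_combination (-(π : ℂ) * a / 2) * Complex.I_sq
  have hv2 : Complex.exp (I * π * (ϱ + I * a / 2)) = u * h := by
    rw [hu, hh, ← Complex.exp_add]; congr 1
    linear_combination ((π : ℂ) * a / 2) * Complex.I_sq
  have hs : s00 = I * (u ^ 2 + (u⁻¹) ^ 2) := by
    have : Complex.cos (2 * π * ϱ) = (u ^ 2 + (u⁻¹) ^ 2) / 2 := by
      rw [Complex.cos, hu, ← Complex.exp_neg, ← Complex.exp_nat_mul, ← Complex.exp_nat_mul]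
      congr 3 <;> push_cast <;> ring
    rw [this] at hcos
    linear_combination -2 * I * hcos + s00 * Complex.I_sq
  rw [hv1] at hR1
  rw [hv2] at hR2
  rw [hE] at h2 ⊢
  rw [Complex.exp_neg, Complex.exp_neg, ← hu, ← hq] at hw₁ hw₂ hw₃ hw₄
  have hqi : (q⁻¹) ^ 2 = -I := by rw [inv_pow, hqq, Complex.inv_I]
  have hqc : q * q⁻¹ = 1 := mul_inv_cancel₀ hq0
  have huc : u * u⁻¹ = 1 := mul_inv_cancel₀ hu0
  have hA14 : (g11 * q * u⁻¹ + g21 * q⁻¹ * u) * (g12 * q * u + g22 * q⁻¹ * u⁻¹) = h ^ 2 - u ^ 2 := by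
    rw [hs] at h2
    have e : (g11 * q * u⁻¹ + g21 * q⁻¹ * u) * (g12 * q * u + g22 * q⁻¹ * u⁻¹) =
        q ^ 2 * (u * u⁻¹) * g11 * g12 + (q * q⁻¹) * (u⁻¹ ^ 2 * g11 * g22 + u ^ 2 * g12 * g21) +
        q⁻¹ ^ 2 * (u * u⁻¹) * g21 * g22 := by ring
    rw [e, hqq, hqi, hqc, huc]
    linear_combination -I * h2 - u ^ 2 * h5 +
      ((u ^ 2 + u⁻¹ ^ 2) * g11 * g22 - h ^ 2) * Complex.I_sq
  have hA23 : (g11 * q * u + g21 * q⁻¹ * u⁻¹) * (g12 * q * u⁻¹ + g22 * q⁻¹ * u) =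
      h ^ 2 - u⁻¹ ^ 2 := by
    rw [hs] at h2
    have e : (g11 * q * u + g21 * q⁻¹ * u⁻¹) * (g12 * q * u⁻¹ + g22 * q⁻¹ * u) =
        q ^ 2 * (u * u⁻¹) * g11 * g12 + (q * q⁻¹) * (u ^ 2 * g11 * g22 + u⁻¹ ^ 2 * g12 * g21) +
        q⁻¹ ^ 2 * (u * u⁻¹) * g21 * g22 := by ring
    rw [e, hqq, hqi, hqc, huc]
    linear_combination -I * h2 - u⁻¹ ^ 2 * h5 +
      ((u ^ 2 + u⁻¹ ^ 2) * g11 * g22 - h ^ 2) * Complex.I_sq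
  have hP14 : Complex.exp ((Real.log (ε * b / 2) + I * π / 2) * (1 / 2 - ϱ)) *
      Complex.exp ((Real.log (ε * b / 2) - I * π / 2) * (ϱ - 1 / 2)) = I * u⁻¹ := by
    have hI : I * u⁻¹ = Complex.exp (π / 2 * I) * u⁻¹ := by rw [Complex.exp_pi_div_two_mul_I]
    rw [hI, hu, ← Complex.exp_neg, ← Complex.exp_add, ← Complex.exp_add]
    congr 1; ring
  have hP23 : Complex.exp ((Real.log (ε * b / 2) + I * π / 2) * (ϱ - 1 / 2)) *
      Complex.exp ((Real.log (ε * b / 2) - I * π / 2) * (1 / 2 - ϱ)) = -I * u := by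
    rw [hu, ← Complex.exp_neg_pi_div_two_mul_I, ← Complex.exp_add, ← Complex.exp_add]
    congr 1; ring
  have hGc : Complex.Gamma (2 * ϱ) / Complex.Gamma (2 - 2 * ϱ) *
      (Complex.Gamma (2 - 2 * ϱ) / Complex.Gamma (2 * ϱ)) = 1 := by
    rw [div_mul_div_cancel₀ hG2, div_self hG1]
  have h14 : w₁ * w₄ = 2 * π * h := by
    calc w₁ * w₄ = _ := by rw [hw₁, hw₄]
      _ = (Complex.exp ((Real.log (ε * b / 2) + I * π / 2) * (1 / 2 - ϱ)) *
          Complex.exp ((Real.log (ε * b / 2) - I * π / 2) * (ϱ - 1 / 2))) *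
          (Complex.Gamma (2 * ϱ) / Complex.Gamma (2 - 2 * ϱ) *
          (Complex.Gamma (2 - 2 * ϱ) / Complex.Gamma (2 * ϱ))) *
          (Complex.Gamma (1 - ϱ + I * a / 2) * Complex.Gamma (ϱ - I * a / 2)) *
          ((g11 * q * u⁻¹ + g21 * q⁻¹ * u) * (g12 * q * u + g22 * q⁻¹ * u⁻¹)) := by ring
      _ = I * u⁻¹ * (-(h ^ 2)) * (Complex.Gamma (1 - ϱ + I * a / 2) *
          Complex.Gamma (ϱ - I * a / 2) * ((u * h⁻¹) ^ 2 - 1)) := by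
        rw [hP14, hGc, hA14]; field_simp; ring
      _ = 2 * π * h := by
        rw [hR1]; field_simp; linear_combination -Complex.I_sq
  have h23 : w₂ * w₃ = 2 * π * h := by
    calc w₂ * w₃ = _ := by rw [hw₂, hw₃]
      _ = (Complex.exp ((Real.log (ε * b / 2) + I * π / 2) * (ϱ - 1 / 2)) *
          Complex.exp ((Real.log (ε * b / 2) - I * π / 2) * (1 / 2 - ϱ))) *
          (Complex.Gamma (2 * ϱ) / Complex.Gamma (2 - 2 * ϱ) *
          (Complex.Gamma (2 - 2 * ϱ) / Complex.Gamma (2 * ϱ))) *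
          (Complex.Gamma (1 - ϱ - I * a / 2) * Complex.Gamma (ϱ + I * a / 2)) *
          ((g11 * q * u + g21 * q⁻¹ * u⁻¹) * (g12 * q * u⁻¹ + g22 * q⁻¹ * u)) := by ring
      _ = -I * u⁻¹ * (Complex.Gamma (1 - ϱ - I * a / 2) *
          Complex.Gamma (ϱ + I * a / 2) * ((u * h) ^ 2 - 1)) := by
        rw [hP23, hGc, hA23]; field_simp
      _ = 2 * π * h := by
        rw [hR2]; field_simp; linear_combination -Complex.I_sq
  refine ⟨?_, h14.trans h23.symm⟩
  calc w₁ * w₂ * w₃ * w₄ = (w₁ * w₄) * (w₂ * w₃) := by ring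
    _ = (2 * π) ^ 2 * h ^ 2 := by rw [h14, h23]; ring
end

section
/- Suppose the monodromy data (a, s₀⁰, s₀^∞, s₁^∞, g₁₁, g₁₂, g₂₁, g₂₂) satisfy the monodromy manifold equations, exp(2πa) ≠ 1 (equivalently a ∉ iℤ), s₀^∞ = 0, and s₁^∞ ≠ 0. Then g₂₁ ≠ 0, and: s₀⁰ = 2i·cosh(πa); g₁₁ = i·exp(−πa)·g₂₁; g₁₂ = −(exp(πa) + i·s₁^∞·g₂₁²)/(2·sinh(πa)·g₂₁); g₂₂ = (i − exp(πa)·s₁^∞·g₂₁²)/(2·sinh(πa)·g₂₁). -/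
open Complex Real

/-- Monodromy data of the special solutions with `s₀^∞ = 0`, `s₁^∞ ≠ 0`
(Theorem 4.1, equations (4.2)). -/
theorem monodromy_s0inf_eq_zero
    (a s00 s0inf s1inf g11 g12 g21 g22 : ℂ)
    (h1 : s0inf * s1inf =
      -1 - Complex.exp (-(2 * (π : ℂ)) * a) - I * s00 * Complex.exp (-(π : ℂ) * a))
    (h2 : g21 * g22 - g11 * g12 + s00 * g11 * g22 = I * Complex.exp (-(π : ℂ) * a))
    (h3 : g11 ^ 2 - g21 ^ 2 - s00 * g11 * g21 = I * s0inf * Complex.exp (-(π : ℂ) * a))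
    (h4 : g22 ^ 2 - g12 ^ 2 + s00 * g12 * g22 = I * s1inf * Complex.exp ((π : ℂ) * a))
    (h5 : g11 * g22 - g12 * g21 = 1)
    (ha : Complex.exp (2 * (π : ℂ) * a) ≠ 1)
    (hs0 : s0inf = 0) (hs1 : s1inf ≠ 0) :
    g21 ≠ 0 ∧
    s00 = 2 * I * Complex.cosh ((π : ℂ) * a) ∧
    g11 = I * Complex.exp (-(π : ℂ) * a) * g21 ∧
    g12 = -((Complex.exp ((π : ℂ) * a) + I * s1inf * g21 ^ 2) /
      (2 * Complex.sinh ((π : ℂ) * a) * g21)) ∧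
    g22 = (I - Complex.exp ((π : ℂ) * a) * s1inf * g21 ^ 2) /
      (2 * Complex.sinh ((π : ℂ) * a) * g21) := by
  have hE2 : Complex.exp (2 * (π : ℂ) * a) = Complex.exp ((π : ℂ) * a) ^ 2 := by
    rw [← Complex.exp_nat_mul]; congr 1; push_cast; ring
  have he2 : Complex.exp (-(2 * (π : ℂ)) * a) = Complex.exp (-(π : ℂ) * a) ^ 2 := by
    rw [← Complex.exp_nat_mul]; congr 1; push_cast; ring
  have hEe : Complex.exp ((π : ℂ) * a) * Complex.exp (-(π : ℂ) * a) = 1 := by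
    rw [← Complex.exp_add, neg_mul, add_neg_cancel, Complex.exp_zero]
  have hcosh : 2 * Complex.cosh ((π : ℂ) * a) =
      Complex.exp ((π : ℂ) * a) + Complex.exp (-(π : ℂ) * a) := by
    rw [Complex.two_cosh, neg_mul]
  have hsinh : 2 * Complex.sinh ((π : ℂ) * a) =
      Complex.exp ((π : ℂ) * a) - Complex.exp (-(π : ℂ) * a) := by
    rw [Complex.two_sinh, neg_mul]
  rw [hE2] at ha
  rw [he2, hs0] at h1
  rw [hs0] at h3
  rw [hsinh, mul_right_comm, hcosh]
  have hI : I ^ 2 = -1 := Complex.I_sq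
  generalize Complex.exp ((π : ℂ) * a) = E at *
  generalize Complex.exp (-(π : ℂ) * a) = e at *
  have hs : s00 = (E + e) * I := by
    linear_combination -E * I * h1 + (e * I - s00) * hEe + s00 * E * e * hI
  subst hs
  have hfac : (g11 - I * E * g21) * (g11 - I * e * g21) = 0 := by
    linear_combination h3 + g21 ^ 2 * E * e * hI - g21 ^ 2 * hEe
  have hg11 : g11 = I * e * g21 := by
    rcases mul_eq_zero.mp hfac with h | h
    · refine absurd ?_ ha
      have hg : g11 = I * E * g21 := sub_eq_zero.mp h
      subst hg
      have hIE : I * E = I * e := by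
        linear_combination h2 - I * E * h5 - g21 * g22 * E * e * hI + g21 * g22 * hEe
      have hEq : E = e := mul_left_cancel₀ Complex.I_ne_zero hIE
      linear_combination E * hEq + hEe
    · exact sub_eq_zero.mp h
  have hg21 : g21 ≠ 0 := by
    rintro rfl
    simp [hg11] at h5
  have hd : E - e ≠ 0 := fun h => ha (by linear_combination E * h + hEe)
  subst hg11
  have hE0 : E ≠ 0 := left_ne_zero_of_mul_eq_one hEe
  have hp : g21 * (g22 + I * E * g12) = -I * E := by
    linear_combination -I * E * h5 + (g21 * g22 * E * e) * hI - g21 * g22 * hEe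
  have hq : g22 + I * e * g12 = -s1inf * g21 := by
    have hIE : I * E ≠ 0 := mul_ne_zero Complex.I_ne_zero hE0
    apply mul_left_cancel₀ hIE
    linear_combination (g22 + I * e * g12) * hp - g21 * h4 - g21 * g12 ^ 2 * E * e * hI
      + g21 * g12 ^ 2 * hEe
  refine ⟨hg21, by ring, rfl, ?_, ?_⟩
  · rw [← neg_div, eq_div_iff (mul_ne_zero hd hg21)]
    linear_combination -I * hp + I * g21 * hq + (g12 * g21 * (E - e) + E) * hI
  · rw [eq_div_iff (mul_ne_zero hd hg21)]
    linear_combination -e * hp + E * g21 * hq + I * hEe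
end

section
/- Suppose the monodromy data (a, s₀⁰, s₀^∞, s₁^∞, g₁₁, g₁₂, g₂₁, g₂₂) satisfy the monodromy manifold equations, exp(2πa) ≠ 1 (equivalently a ∉ iℤ), s₁^∞ = 0, and s₀^∞ ≠ 0. Then g₁₂ ≠ 0, and: s₀⁰ = 2i·cosh(πa); g₁₁ = (s₀^∞·g₁₂²·exp(−πa) − i)/(2·sinh(πa)·g₁₂); g₂₁ = −(exp(πa) + i·s₀^∞·g₁₂²·exp(−2πa))/(2·sinh(πa)·g₁₂); g₂₂ = −i·exp(−πa)·g₁₂. -/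
open Complex Real

/-- Monodromy data of the special solutions with `s₁^∞ = 0`, `s₀^∞ ≠ 0`
(Theorem 4.2, equations (4.24)). -/
theorem monodromy_s1inf_eq_zero
    (a s00 s0inf s1inf g11 g12 g21 g22 : ℂ)
    (h1 : s0inf * s1inf =
      -1 - Complex.exp (-(2 * (π : ℂ)) * a) - I * s00 * Complex.exp (-(π : ℂ) * a))
    (h2 : g21 * g22 - g11 * g12 + s00 * g11 * g22 = I * Complex.exp (-(π : ℂ) * a))
    (h3 : g11 ^ 2 - g21 ^ 2 - s00 * g11 * g21 = I * s0inf * Complex.exp (-(π : ℂ) * a))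
    (h4 : g22 ^ 2 - g12 ^ 2 + s00 * g12 * g22 = I * s1inf * Complex.exp ((π : ℂ) * a))
    (h5 : g11 * g22 - g12 * g21 = 1)
    (ha : Complex.exp (2 * (π : ℂ) * a) ≠ 1)
    (hs1 : s1inf = 0) (hs0 : s0inf ≠ 0) :
    g12 ≠ 0 ∧
    s00 = 2 * I * Complex.cosh ((π : ℂ) * a) ∧
    g11 = (s0inf * g12 ^ 2 * Complex.exp (-(π : ℂ) * a) - I) /
      (2 * Complex.sinh ((π : ℂ) * a) * g12) ∧
    g21 = -((Complex.exp ((π : ℂ) * a) + I * s0inf * g12 ^ 2 * Complex.exp (-(2 * (π : ℂ)) * a)) /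
      (2 * Complex.sinh ((π : ℂ) * a) * g12)) ∧
    g22 = -(I * Complex.exp (-(π : ℂ) * a) * g12) := by
  subst hs1
  have hEe : Complex.exp ((π : ℂ) * a) * Complex.exp (-(π : ℂ) * a) = 1 := by
    rw [← Complex.exp_add]; simp
  have he2 : Complex.exp (-(2 * (π : ℂ)) * a) = Complex.exp (-(π : ℂ) * a) ^ 2 := by
    rw [← Complex.exp_nat_mul]; congr 1; push_cast; ring
  have hE2 : Complex.exp (2 * (π : ℂ) * a) = Complex.exp ((π : ℂ) * a) ^ 2 := by
    rw [← Complex.exp_nat_mul]; congr 1; push_cast; ring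
  have hcosh : 2 * Complex.cosh ((π : ℂ) * a) =
      Complex.exp ((π : ℂ) * a) + Complex.exp (-(π : ℂ) * a) := by
    rw [Complex.two_cosh, neg_mul]
  have hsinh : 2 * Complex.sinh ((π : ℂ) * a) =
      Complex.exp ((π : ℂ) * a) - Complex.exp (-(π : ℂ) * a) := by
    rw [Complex.two_sinh, neg_mul]
  rw [hE2] at ha
  rw [he2] at h1
  rw [he2, hsinh, mul_right_comm 2 I, hcosh]
  generalize Complex.exp ((π : ℂ) * a) = E at *
  generalize Complex.exp (-(π : ℂ) * a) = e at *
  have hI : I ^ 2 = -1 := I_sq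
  have hs : s00 = (E + e) * I := by
    linear_combination (-I * E) * h1 + (e * I - s00) * hEe + E * e * s00 * hI
  subst hs
  have hd : E - e ≠ 0 := fun h => ha (by linear_combination E * h + hEe)
  have hfac : (g22 + I * E * g12) * (g22 + I * e * g12) = 0 := by
    linear_combination h4 + g12 ^ 2 * hI * E * e - g12 ^ 2 * hEe
  have hg22 : g22 = -(I * e * g12) := by
    rcases mul_eq_zero.mp hfac with h | h
    · have h' : g22 = -(I * E * g12) := by linear_combination h
      subst h'
      exfalso
      have : I * (E - e) = 0 := by
        linear_combination h2 - I * E * h5 + g11 * g12 * I ^ 2 * hEe + g11 * g12 * hI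
      exact hd ((mul_eq_zero.mp this).resolve_left I_ne_zero)
    · linear_combination h
  have hg12 : g12 ≠ 0 := by
    rintro rfl
    simp [hg22] at h5
  subst hg22
  have hlin : g21 + I * E * g11 = I * s0inf * e * g12 := by
    linear_combination g12 * h3 - (g21 + I * E * g11) * h5 - g11 ^ 2 * g12 * (I ^ 2 * hEe + hI)
  have hg11 : g11 * ((E - e) * g12) = s0inf * g12 ^ 2 * e - I := by
    linear_combination (-I * g12) * hlin - I * h5 +
      (g11 * E * g12 - g11 * e * g12 - e * g12 ^ 2 * s0inf) * hI
  have hg21 : g21 * ((E - e) * g12) = -(E + I * s0inf * g12 ^ 2 * e ^ 2) := by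
    linear_combination (E - e) * g12 * hlin - I * E * hg11 + E * hI
  refine ⟨hg12, by ring, ?_, ?_, rfl⟩
  · rw [eq_div_iff (mul_ne_zero hd hg12), hg11]
  · rw [← neg_div, eq_div_iff (mul_ne_zero hd hg12), hg21]
end

section
/- Suppose the monodromy data (a, s₀⁰, s₀^∞, s₁^∞, g₁₁, g₁₂, g₂₁, g₂₂) satisfy the monodromy manifold equations and, in addition, s₀⁰ = 2i·cosh(πa). Then the transformed tuple (a', s₀⁰', s₀^∞', s₁^∞', g₁₁', g₁₂', g₂₁', g₂₂') := (−a, s₀⁰, −s₁^∞, −s₀^∞, g₁₂, −g₁₁, g₂₂, −g₂₁) also satisfies the monodromy manifold equations (with a replaced by −a throughout). -/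
open Complex Real

/-- The symmetry (4.32): the transformation
`(a, s₀⁰, s₀^∞, s₁^∞, g₁₁, g₁₂, g₂₁, g₂₂) ↦ (−a, s₀⁰, −s₁^∞, −s₀^∞, g₁₂, −g₁₁, g₂₂, −g₂₁)`
maps points of the monodromy manifold with `s₀⁰ = 2i cosh(πa)` to points of the monodromy
manifold with parameter of formal monodromy `−a`. -/
theorem monodromy_symmetry
    (a s00 s0inf s1inf g11 g12 g21 g22 : ℂ)
    (h1 : s0inf * s1inf =
      -1 - Complex.exp (-(2 * (π : ℂ)) * a) - I * s00 * Complex.exp (-(π : ℂ) * a))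
    (h2 : g21 * g22 - g11 * g12 + s00 * g11 * g22 = I * Complex.exp (-(π : ℂ) * a))
    (h3 : g11 ^ 2 - g21 ^ 2 - s00 * g11 * g21 = I * s0inf * Complex.exp (-(π : ℂ) * a))
    (h4 : g22 ^ 2 - g12 ^ 2 + s00 * g12 * g22 = I * s1inf * Complex.exp ((π : ℂ) * a))
    (h5 : g11 * g22 - g12 * g21 = 1)
    (hs00 : s00 = 2 * I * Complex.cosh ((π : ℂ) * a)) :
    ((-s1inf) * (-s0inf) =
      -1 - Complex.exp (-(2 * (π : ℂ)) * (-a)) - I * s00 * Complex.exp (-(π : ℂ) * (-a))) ∧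
    (g22 * (-g21) - g12 * (-g11) + s00 * g12 * (-g21) = I * Complex.exp (-(π : ℂ) * (-a))) ∧
    (g12 ^ 2 - g22 ^ 2 - s00 * g12 * g22 = I * (-s1inf) * Complex.exp (-(π : ℂ) * (-a))) ∧
    ((-g21) ^ 2 - (-g11) ^ 2 + s00 * (-g11) * (-g21) =
      I * (-s0inf) * Complex.exp ((π : ℂ) * (-a))) ∧
    (g12 * (-g21) - (-g11) * g22 = 1) := by
  have hneg : Complex.exp (-(π : ℂ) * -a) = Complex.exp (π * a) := by
    congr 1; ring
  have hneg' : Complex.exp ((π : ℂ) * -a) = Complex.exp (-π * a) := by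
    congr 1; ring
  have hsq : Complex.exp (-(2 * (π : ℂ)) * a) = Complex.exp (-π * a) ^ 2 := by
    rw [← Complex.exp_nat_mul]; congr 1; push_cast; ring
  have hsq' : Complex.exp (-(2 * (π : ℂ)) * -a) = Complex.exp (π * a) ^ 2 := by
    rw [← Complex.exp_nat_mul]; congr 1; push_cast; ring
  have hs : s00 = I * (Complex.exp (π * a) + Complex.exp (-π * a)) := by
    rw [hs00, Complex.cosh, neg_mul]; ring
  have hinv : Complex.exp ((π : ℂ) * a) * Complex.exp (-π * a) = 1 := by
    rw [← Complex.exp_add, neg_mul, add_neg_cancel, Complex.exp_zero]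
  rw [hneg, hneg', hsq']
  rw [hsq] at h1
  generalize Complex.exp ((π : ℂ) * a) = E at *
  generalize Complex.exp (-(π : ℂ) * a) = F at *
  refine ⟨?_, ?_, ?_, ?_, ?_⟩
  · linear_combination h1 + I * (E - F) * hs + (E ^ 2 - F ^ 2) * I_sq
  · linear_combination s00 * h5 - h2 + hs
  · linear_combination -h4
  · linear_combination -h3
  · linear_combination h5
end

section
/- Suppose the monodromy data (a, s₀⁰, s₀^∞, s₁^∞, g₁₁, g₁₂, g₂₁, g₂₂) satisfy the monodromy manifold equations, exp(πa) ≠ 1 (equivalently a ∉ 2iℤ), and s₀⁰ = 2i. Then: (g₁₁ − i·g₂₁)·(g₁₂ − i·g₂₂) = i·(1 − exp(−πa)) ≠ 0; (g₁₁ − i·g₂₁)² = i·s₀^∞·exp(−πa) ≠ 0; and (g₁₂ − i·g₂₂)² = −i·s₁^∞·exp(πa) ≠ 0. -/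
open Complex Real

/-- Theorem 5.1 (monodromy part): for monodromy data with `a ∉ 2iℤ` and `s₀⁰ = 2i`, the
combinations `(g₁₁ − i g₂₁)(g₁₂ − i g₂₂)`, `(g₁₁ − i g₂₁)²`, `(g₁₂ − i g₂₂)²` are nonzero and
are expressed through the Stokes multipliers. -/
theorem monodromy_s00_eq_two_i
    (a s00 s0inf s1inf g11 g12 g21 g22 : ℂ)
    (h1 : s0inf * s1inf =
      -1 - Complex.exp (-(2 * (π : ℂ)) * a) - I * s00 * Complex.exp (-(π : ℂ) * a))
    (h2 : g21 * g22 - g11 * g12 + s00 * g11 * g22 = I * Complex.exp (-(π : ℂ) * a))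
    (h3 : g11 ^ 2 - g21 ^ 2 - s00 * g11 * g21 = I * s0inf * Complex.exp (-(π : ℂ) * a))
    (h4 : g22 ^ 2 - g12 ^ 2 + s00 * g12 * g22 = I * s1inf * Complex.exp ((π : ℂ) * a))
    (h5 : g11 * g22 - g12 * g21 = 1)
    (ha : Complex.exp ((π : ℂ) * a) ≠ 1)
    (hs00 : s00 = 2 * I) :
    ((g11 - I * g21) * (g12 - I * g22) = I * (1 - Complex.exp (-(π : ℂ) * a)) ∧
      I * (1 - Complex.exp (-(π : ℂ) * a)) ≠ 0) ∧
    ((g11 - I * g21) ^ 2 = I * s0inf * Complex.exp (-(π : ℂ) * a) ∧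
      I * s0inf * Complex.exp (-(π : ℂ) * a) ≠ 0) ∧
    ((g12 - I * g22) ^ 2 = -(I * s1inf * Complex.exp ((π : ℂ) * a)) ∧
      -(I * s1inf * Complex.exp ((π : ℂ) * a)) ≠ 0) := by
  subst hs00
  have hne : I * (1 - Complex.exp (-(π : ℂ) * a)) ≠ 0 := by
    refine mul_ne_zero I_ne_zero fun h => ha ?_
    rw [← inv_inv (Complex.exp _), ← Complex.exp_neg, ← neg_mul, ← sub_eq_zero.mp h, inv_one]
  have hprod : (g11 - I * g21) * (g12 - I * g22) = I * (1 - Complex.exp (-(π : ℂ) * a)) := by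
    linear_combination -h2 + I * h5 + g21 * g22 * I_sq
  have hsq₁ : (g11 - I * g21) ^ 2 = I * s0inf * Complex.exp (-(π : ℂ) * a) := by
    linear_combination h3 + g21 ^ 2 * I_sq
  have hsq₂ : (g12 - I * g22) ^ 2 = -(I * s1inf * Complex.exp ((π : ℂ) * a)) := by
    linear_combination -h4 + g22 ^ 2 * I_sq
  have hfactors := mul_ne_zero_iff.mp (hprod ▸ hne)
  exact ⟨⟨hprod, hne⟩, ⟨hsq₁, hsq₁ ▸ pow_ne_zero 2 hfactors.1⟩,
    ⟨hsq₂, hsq₂ ▸ pow_ne_zero 2 hfactors.2⟩⟩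
end

section
/- Suppose the monodromy data (a, s₀⁰, s₀^∞, s₁^∞, g₁₁, g₁₂, g₂₁, g₂₂) satisfy the monodromy manifold equations, exp(πa) ≠ −1 (equivalently a ∉ {i(2m−1) : m ∈ ℤ}), and s₀⁰ = −2i. Then: (g₁₁ + i·g₂₁)·(g₁₂ + i·g₂₂) = −i·(1 + exp(−πa)) ≠ 0; (g₁₁ + i·g₂₁)² = i·s₀^∞·exp(−πa) ≠ 0; and (g₁₂ + i·g₂₂)² = −i·s₁^∞·exp(πa) ≠ 0. -/
open Complex Real

/-- Theorem 6.2 (monodromy part): for monodromy data with `a ∉ {i(2m−1) : m ∈ ℤ}` and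
`s₀⁰ = −2i`, the combinations `(g₁₁ + i g₂₁)(g₁₂ + i g₂₂)`, `(g₁₁ + i g₂₁)²`, `(g₁₂ + i g₂₂)²`
are nonzero and are expressed through the Stokes multipliers. -/
theorem monodromy_s00_eq_neg_two_i
    (a s00 s0inf s1inf g11 g12 g21 g22 : ℂ)
    (h1 : s0inf * s1inf =
      -1 - Complex.exp (-(2 * (π : ℂ)) * a) - I * s00 * Complex.exp (-(π : ℂ) * a))
    (h2 : g21 * g22 - g11 * g12 + s00 * g11 * g22 = I * Complex.exp (-(π : ℂ) * a))
    (h3 : g11 ^ 2 - g21 ^ 2 - s00 * g11 * g21 = I * s0inf * Complex.exp (-(π : ℂ) * a))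
    (h4 : g22 ^ 2 - g12 ^ 2 + s00 * g12 * g22 = I * s1inf * Complex.exp ((π : ℂ) * a))
    (h5 : g11 * g22 - g12 * g21 = 1)
    (ha : Complex.exp ((π : ℂ) * a) ≠ -1)
    (hs00 : s00 = -(2 * I)) :
    ((g11 + I * g21) * (g12 + I * g22) = -(I * (1 + Complex.exp (-(π : ℂ) * a))) ∧
      -(I * (1 + Complex.exp (-(π : ℂ) * a))) ≠ 0) ∧
    ((g11 + I * g21) ^ 2 = I * s0inf * Complex.exp (-(π : ℂ) * a) ∧
      I * s0inf * Complex.exp (-(π : ℂ) * a) ≠ 0) ∧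
    ((g12 + I * g22) ^ 2 = -(I * s1inf * Complex.exp ((π : ℂ) * a)) ∧
      -(I * s1inf * Complex.exp ((π : ℂ) * a)) ≠ 0) := by
  subst hs00
  have hI : I ^ 2 = -1 := I_sq
  have hprod : (g11 + I * g21) * (g12 + I * g22) =
      -(I * (1 + Complex.exp (-(π : ℂ) * a))) := by
    linear_combination -h2 - I * h5 + g21 * g22 * hI
  have hsq₁ : (g11 + I * g21) ^ 2 = I * s0inf * Complex.exp (-(π : ℂ) * a) := by
    linear_combination h3 + g21 ^ 2 * hI
  have hsq₂ : (g12 + I * g22) ^ 2 = -(I * s1inf * Complex.exp ((π : ℂ) * a)) := by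
    linear_combination -h4 + g22 ^ 2 * hI
  have hne : -(I * (1 + Complex.exp (-(π : ℂ) * a))) ≠ 0 := by
    refine neg_ne_zero.mpr (mul_ne_zero I_ne_zero fun h => ha ?_)
    have hexp : Complex.exp ((π : ℂ) * a) * Complex.exp (-(π : ℂ) * a) = 1 := by
      rw [← Complex.exp_add, neg_mul, add_neg_cancel, Complex.exp_zero]
    linear_combination Complex.exp ((π : ℂ) * a) * h - hexp
  have hfactors := mul_ne_zero_iff.mp (hprod ▸ hne)
  exact ⟨⟨hprod, hne⟩, ⟨hsq₁, hsq₁ ▸ pow_ne_zero 2 hfactors.1⟩,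
    ⟨hsq₂, hsq₂ ▸ pow_ne_zero 2 hfactors.2⟩⟩
end

section
/- Suppose the monodromy data (a, s₀⁰, s₀^∞, s₁^∞, g₁₁, g₁₂, g₂₁, g₂₂) satisfy the monodromy manifold equations with s₀⁰ = −2i and exp(πa) ≠ −1. Then Γ(1/2 + ia/2)·Γ(1/2 − ia/2)·(g₁₁ + i·g₂₁)·(g₁₂ + i·g₂₂) = −2πi·exp(−πa/2), where Γ is the complex Gamma function. -/
open Complex Real

/-- Lemma 6.1 (second part): coincidence of the multiplicative constants in the two small-`τ`
asymptotic formulae for the mole function in the case `s₀⁰ = −2i`: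
`Γ(1/2 + ia/2)·Γ(1/2 − ia/2)·(g₁₁ + i g₂₁)·(g₁₂ + i g₂₂) = −2πi·e^{−πa/2}`. -/
theorem mole_multiplicative_constant
    (a s00 s0inf s1inf g11 g12 g21 g22 : ℂ)
    (h1 : s0inf * s1inf =
      -1 - Complex.exp (-(2 * (π : ℂ)) * a) - I * s00 * Complex.exp (-(π : ℂ) * a))
    (h2 : g21 * g22 - g11 * g12 + s00 * g11 * g22 = I * Complex.exp (-(π : ℂ) * a))
    (h3 : g11 ^ 2 - g21 ^ 2 - s00 * g11 * g21 = I * s0inf * Complex.exp (-(π : ℂ) * a))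
    (h4 : g22 ^ 2 - g12 ^ 2 + s00 * g12 * g22 = I * s1inf * Complex.exp ((π : ℂ) * a))
    (h5 : g11 * g22 - g12 * g21 = 1)
    (hs00 : s00 = -(2 * I))
    (ha : Complex.exp ((π : ℂ) * a) ≠ -1) :
    Complex.Gamma (1 / 2 + I * a / 2) * Complex.Gamma (1 / 2 - I * a / 2) *
      (g11 + I * g21) * (g12 + I * g22) =
    -(2 * (π : ℂ) * I * Complex.exp (-((π : ℂ) * a) / 2)) := by
  have hcos : Complex.cos (I * (π * a / 2)) =
      (Complex.exp (π * a / 2) + Complex.exp (-(π * a) / 2)) / 2 := by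
    rw [mul_comm, Complex.cos_mul_I, Complex.cosh, neg_div]
  have hGamma : Complex.Gamma (1 / 2 + I * a / 2) * Complex.Gamma (1 / 2 - I * a / 2) =
      π / Complex.cos (I * (π * a / 2)) := by
    have h := Complex.Gamma_mul_Gamma_one_sub (1 / 2 + I * a / 2)
    rw [show 1 - (1 / 2 + I * a / 2) = 1 / 2 - I * a / 2 by ring,
      show (π : ℂ) * (1 / 2 + I * a / 2) = I * (π * a / 2) + π / 2 by ring,
      Complex.sin_add_pi_div_two] at h
    exact h
  have hprod : (g11 + I * g21) * (g12 + I * g22) =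
      -I * (1 + Complex.exp (-(π : ℂ) * a)) := by
    subst hs00
    linear_combination -h2 - I * h5 + g21 * g22 * I_sq
  have hinv : Complex.exp (π * a / 2) * Complex.exp (-(π * a) / 2) = 1 := by
    rw [← Complex.exp_add, neg_div, add_neg_cancel, Complex.exp_zero]
  have hsq : Complex.exp (-(π : ℂ) * a) = Complex.exp (-(π * a) / 2) ^ 2 := by
    rw [← Complex.exp_nat_mul]
    congr 1
    push_cast
    ring
  have hsq' : Complex.exp ((π : ℂ) * a) = Complex.exp (π * a / 2) ^ 2 := by
    rw [← Complex.exp_nat_mul]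
    congr 1
    push_cast
    ring
  have hne : Complex.exp (π * a / 2) + Complex.exp (-(π * a) / 2) ≠ 0 := by
    intro h
    apply ha
    rw [hsq']
    linear_combination Complex.exp (π * a / 2) * h - hinv
  rw [mul_assoc, hprod, hGamma, hcos, hsq]
  generalize Complex.exp (π * a / 2) = x at hinv hne ⊢
  generalize Complex.exp (-(π * a) / 2) = y at hinv hne ⊢
  field_simp
  linear_combination hinv
end

section
/- Suppose the monodromy data (a, s₀⁰, s₀^∞, s₁^∞, g₁₁, g₁₂, g₂₁, g₂₂) satisfy the monodromy manifold equations with s₀^∞ = 0 and s₁^∞ = 0. Then exp(2πa) ≠ 1 (equivalently a ∉ iℤ), and: s₀⁰ = 2i·cosh(πa); g₁₁ = i·exp(−πa)·g₂₁; g₂₂ = −i·exp(−πa)·g₁₂; and g₁₂·g₂₁ = −exp(πa)/(2·sinh(πa)). -/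
open Complex Real

/-- The algebraic content of the monodromy equations with vanishing Stokes multipliers at infinity,
with `E` and `q` standing for `exp (π a)` and `exp (-π a)`. -/
theorem connection_entries_of_stokes_eq_zero {E q s x y z w : ℂ} (hEq : E * q = 1)
    (h1 : 0 = -1 - q ^ 2 - I * s * q)
    (h2 : z * w - x * y + s * x * w = I * q)
    (h3 : x ^ 2 - z ^ 2 - s * x * z = 0)
    (h4 : w ^ 2 - y ^ 2 + s * y * w = 0)
    (h5 : x * w - y * z = 1) :
    s = I * (E + q) ∧ x = I * q * z ∧ w = -(I * q * y) ∧ (q ^ 2 - 1) * (y * z) = 1 := by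
  have hI : I ^ 2 = -1 := I_sq
  have hs : s = I * (E + q) := by
    linear_combination (-I * E) * h1 - s * hEq + I * q * hEq + s * E * q * hI
  subst hs
  have hx : (x - I * E * z) * (x - I * q * z) = 0 := by
    linear_combination h3 + z ^ 2 * E * q * hI - z ^ 2 * hEq
  have hw : (w + I * E * y) * (w + I * q * y) = 0 := by
    linear_combination h4 + y ^ 2 * E * q * hI - y ^ 2 * hEq
  rcases mul_eq_zero.mp hx with hx | hx <;> rcases mul_eq_zero.mp hw with hw | hw
  · obtain rfl : x = I * E * z := by linear_combination hx
    obtain rfl : w = -(I * E * y) := by linear_combination hw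
    have hP : (E ^ 2 - 1) * (y * z) = 1 := by
      linear_combination h5 + E ^ 2 * y * z * hI
    have hIE : I * E = I * q := by
      linear_combination h2 - I * E * hP + I * E ^ 2 * (E + q) * y * z * hI
        - I * E * y * z * hEq
    have hE : E = q := mul_left_cancel₀ I_ne_zero hIE
    subst hE
    exact absurd hP (by simp [sq, hEq])
  · obtain rfl : x = I * E * z := by linear_combination hx
    obtain rfl : w = -(I * q * y) := by linear_combination hw
    exact absurd (show (0 : ℂ) = 1 by
      linear_combination h5 + E * q * y * z * hI - y * z * hEq) zero_ne_one
  · obtain rfl : x = I * q * z := by linear_combination hx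
    obtain rfl : w = -(I * E * y) := by linear_combination hw
    exact absurd (show (0 : ℂ) = 1 by
      linear_combination h5 + E * q * y * z * hI - y * z * hEq) zero_ne_one
  · obtain rfl : x = I * q * z := by linear_combination hx
    obtain rfl : w = -(I * q * y) := by linear_combination hw
    exact ⟨rfl, rfl, rfl, by linear_combination h5 + q ^ 2 * y * z * hI⟩

/-- Theorem 7.1 (monodromy part): the monodromy data with `s₀^∞ = s₁^∞ = 0` satisfy
`a ∉ iℤ`, `s₀⁰ = 2i cosh(πa)`, `g₁₁ = i e^{−πa} g₂₁`, `g₂₂ = −i e^{−πa} g₁₂`, and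
`g₁₂ g₂₁ = −e^{πa}/(2 sinh(πa))`. -/
theorem monodromy_s0inf_s1inf_eq_zero
    (a s00 s0inf s1inf g11 g12 g21 g22 : ℂ)
    (h1 : s0inf * s1inf =
      -1 - Complex.exp (-(2 * (π : ℂ)) * a) - I * s00 * Complex.exp (-(π : ℂ) * a))
    (h2 : g21 * g22 - g11 * g12 + s00 * g11 * g22 = I * Complex.exp (-(π : ℂ) * a))
    (h3 : g11 ^ 2 - g21 ^ 2 - s00 * g11 * g21 = I * s0inf * Complex.exp (-(π : ℂ) * a))
    (h4 : g22 ^ 2 - g12 ^ 2 + s00 * g12 * g22 = I * s1inf * Complex.exp ((π : ℂ) * a))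
    (h5 : g11 * g22 - g12 * g21 = 1)
    (hs0 : s0inf = 0) (hs1 : s1inf = 0) :
    Complex.exp (2 * (π : ℂ) * a) ≠ 1 ∧
    s00 = 2 * I * Complex.cosh ((π : ℂ) * a) ∧
    g11 = I * Complex.exp (-(π : ℂ) * a) * g21 ∧
    g22 = -(I * Complex.exp (-(π : ℂ) * a) * g12) ∧
    g12 * g21 = -(Complex.exp ((π : ℂ) * a) / (2 * Complex.sinh ((π : ℂ) * a))) := by
  subst hs0 hs1
  have hEq : Complex.exp ((π : ℂ) * a) * Complex.exp (-(π : ℂ) * a) = 1 := by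
    rw [← Complex.exp_add]; simp
  have hq2 : Complex.exp (-(2 * (π : ℂ)) * a) = Complex.exp (-(π : ℂ) * a) ^ 2 := by
    rw [← Complex.exp_nat_mul]; congr 1; push_cast; ring
  have hE2 : Complex.exp (2 * (π : ℂ) * a) = Complex.exp ((π : ℂ) * a) ^ 2 := by
    rw [← Complex.exp_nat_mul]; congr 1; push_cast; ring
  have hcosh : 2 * Complex.cosh ((π : ℂ) * a) =
      Complex.exp ((π : ℂ) * a) + Complex.exp (-(π : ℂ) * a) := by
    rw [Complex.two_cosh, neg_mul]
  have hsinh : 2 * Complex.sinh ((π : ℂ) * a) =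
      Complex.exp ((π : ℂ) * a) - Complex.exp (-(π : ℂ) * a) := by
    rw [Complex.two_sinh, neg_mul]
  rw [hsinh, hE2]
  rw [hq2] at h1
  generalize Complex.exp ((π : ℂ) * a) = E at *
  generalize Complex.exp (-(π : ℂ) * a) = q at *
  obtain ⟨hs, hx, hw, hP⟩ := connection_entries_of_stokes_eq_zero hEq
    (by simpa using h1) h2 (by simpa using h3) (by simpa using h4) h5
  have hdiff : (q - E) * (g12 * g21) = E := by
    linear_combination E * hP - q * g12 * g21 * hEq
  have hE0 : E ≠ 0 := left_ne_zero_of_mul_eq_one hEq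
  have hEq0 : E - q ≠ 0 := by
    intro h
    apply hE0
    linear_combination -hdiff - g12 * g21 * h
  refine ⟨fun h => hEq0 ?_, by linear_combination hs - I * hcosh, hx, hw, ?_⟩
  · linear_combination q * h - E * hEq
  · rw [← neg_div, eq_div_iff hEq0]
    linear_combination -hdiff
end

section
/- Let n ∈ ℕ with n ≥ 1 and suppose the monodromy data (a, s₀⁰, s₀^∞, s₁^∞, g₁₁, g₁₂, g₂₁, g₂₂) satisfy the monodromy manifold equations with s₁^∞ = 0, a = i(n − 1/2), and g₁₂ ≠ 0. Then: s₀⁰ = 0; g₂₂ = (−1)ⁿ·g₁₂; g₁₁ = ((−1)ⁿ − s₀^∞·g₁₂²)/(2g₁₂); and g₂₁ = −(1 + (−1)ⁿ·s₀^∞·g₁₂²)/(2g₁₂). -/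
open Complex Real

/-- Theorem 7.2 (monodromy part): the monodromy data with `s₁^∞ = 0`, `a = i(n − 1/2)`,
`n ∈ ℕ`, `g₁₂ ≠ 0` (equations (7.5)). -/
theorem monodromy_meromorphic_Ima_positive
    (n : ℕ) (hn : 1 ≤ n)
    (a s00 s0inf s1inf g11 g12 g21 g22 : ℂ)
    (h1 : s0inf * s1inf =
      -1 - Complex.exp (-(2 * (π : ℂ)) * a) - I * s00 * Complex.exp (-(π : ℂ) * a))
    (h2 : g21 * g22 - g11 * g12 + s00 * g11 * g22 = I * Complex.exp (-(π : ℂ) * a))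
    (h3 : g11 ^ 2 - g21 ^ 2 - s00 * g11 * g21 = I * s0inf * Complex.exp (-(π : ℂ) * a))
    (h4 : g22 ^ 2 - g12 ^ 2 + s00 * g12 * g22 = I * s1inf * Complex.exp ((π : ℂ) * a))
    (h5 : g11 * g22 - g12 * g21 = 1)
    (hs1 : s1inf = 0)
    (ha : a = I * ((n : ℂ) - 1 / 2))
    (hg12 : g12 ≠ 0) :
    s00 = 0 ∧
    g22 = (-1 : ℂ) ^ n * g12 ∧
    g11 = ((-1 : ℂ) ^ n - s0inf * g12 ^ 2) / (2 * g12) ∧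
    g21 = -((1 + (-1 : ℂ) ^ n * s0inf * g12 ^ 2) / (2 * g12)) := by
  have hE : Complex.exp (-(π : ℂ) * a) = (-1 : ℂ) ^ n * I := by
    have hsplit : -(π : ℂ) * a = -((n : ℂ) * (π * I)) + π / 2 * I := by rw [ha]; ring
    rw [hsplit, Complex.exp_add, Complex.exp_neg, Complex.exp_nat_mul, Complex.exp_pi_mul_I,
      Complex.exp_pi_div_two_mul_I, ← inv_pow]
    norm_num
  have hE2 : Complex.exp (-(2 * (π : ℂ)) * a) = Complex.exp (-(π : ℂ) * a) ^ 2 := by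
    rw [← Complex.exp_nat_mul]
    congr 1
    push_cast
    ring
  have he : ((-1 : ℂ) ^ n) ^ 2 = 1 := by rw [← pow_mul, mul_comm, pow_mul]; norm_num
  rw [hE2] at h1
  rw [hE] at h1 h2 h3
  generalize (-1 : ℂ) ^ n = e at *
  have hI : I ^ 2 = -1 := Complex.I_sq
  subst hs1
  have hs : s00 = 0 := by
    linear_combination (-e) * h1 + (-s00 - e) * he + (e ^ 3 + s00 * e ^ 2) * hI
  subst hs
  have h2' : g21 * g22 - g11 * g12 = -e := by linear_combination h2 + e * hI
  have h3' : g11 ^ 2 - g21 ^ 2 = -(e * s0inf) := by linear_combination h3 + e * s0inf * hI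
  have h4' : g22 ^ 2 = g12 ^ 2 := by linear_combination h4
  have h22 : g22 = e * g12 := by
    linear_combination (-g22) * h5 - g12 * h2' + g11 * h4'
  subst h22
  have h11 : g11 * (2 * g12) = e - s0inf * g12 ^ 2 := by
    linear_combination e * g12 ^ 2 * h3' + e * (-(g12 * g21) - (e * g11 * g12 - 1)) * h5
      + (e * g11 ^ 2 * g12 ^ 2 - 2 * g11 * g12 - s0inf * g12 ^ 2) * he
  have h21 : g21 * (2 * g12) = -(1 + e * s0inf * g12 ^ 2) := by
    linear_combination e * h11 - 2 * h5 + he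
  have h0 : 2 * g12 ≠ 0 := mul_ne_zero two_ne_zero hg12
  refine ⟨rfl, rfl, eq_div_of_mul_eq h0 h11, ?_⟩
  rw [← neg_div]
  exact eq_div_of_mul_eq h0 h21
end

section
/- Let ε = 1 or ε = −1, b ∈ ℝ with εb > 0, a ∈ ℂ, and let U ⊆ ℂ be an open neighborhood of 0. Suppose u : ℂ → ℂ is analytic on U ∖ {0}, satisfies the cleared form of the degenerate third Painlevé equation at every τ ∈ U ∖ {0}, and is meromorphic at 0 (i.e., for some N ∈ ℕ the function τ ↦ τᴺ·u(τ) extends analytically to 0). Then u has no pole at 0: u itself extends to a function analytic at 0. -/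
open Complex Filter

/-- If `g = τ ^ (k + 1) * u` near a point, the degenerate third Painlevé equation for `u`
becomes a polynomial differential equation for `g`, whose only term without a factor `τ`
is `8 * e * g ^ 3`. -/
lemma painleve_rescaled {u g : ℂ → ℂ} {τ e a b : ℂ} {k : ℕ} (hu : AnalyticAt ℂ u τ)
    (hg : g =ᶠ[nhds τ] fun z => z ^ (k + 1) * u z)
    (heq : τ * u τ * deriv (deriv u) τ =
      τ * (deriv u τ) ^ 2 - u τ * deriv u τ - 8 * e * (u τ) ^ 3 + 2 * a * b * u τ + b ^ 2 * τ) :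
    τ ^ (k + 2) * (g τ * deriv (deriv g) τ - (deriv g τ) ^ 2) + τ ^ (k + 1) * (g τ * deriv g τ) +
      8 * e * (g τ) ^ 3 - 2 * a * b * g τ * τ ^ (2 * k + 2) - b ^ 2 * τ ^ (3 * k + 4) = 0 := by
  have hg' : deriv g =ᶠ[nhds τ]
      fun z => ((k + 1 : ℂ) * z ^ k) * u z + z ^ (k + 1) * deriv u z := by
    filter_upwards [hg.eventuallyEq_nhds, hu.eventually_analyticAt] with z hz huz
    rw [hz.deriv_eq]
    have h := (hasDerivAt_pow (k + 1) z).mul huz.differentiableAt.hasDerivAt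
    refine h.deriv.trans ?_
    simp
  have hg'' : deriv (deriv g) τ =
      ((k + 1 : ℂ) * (k * τ ^ (k - 1))) * u τ + ((k + 1 : ℂ) * τ ^ k) * deriv u τ +
        (((k + 1 : ℂ) * τ ^ k) * deriv u τ + τ ^ (k + 1) * deriv (deriv u) τ) := by
    rw [hg'.deriv_eq]
    have h := (((hasDerivAt_pow k τ).const_mul (k + 1 : ℂ)).mul
      hu.differentiableAt.hasDerivAt).add
      ((hasDerivAt_pow (k + 1) τ).mul hu.deriv.differentiableAt.hasDerivAt)
    refine h.deriv.trans ?_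
    simp
  have hk : τ * (k * τ ^ (k - 1)) = k * τ ^ k := by
    cases k with
    | zero => simp
    | succ m => simp only [Nat.add_sub_cancel]; ring
  rw [hg'', hg'.self_of_nhds, hg.self_of_nhds]
  linear_combination τ ^ (3 * k + 3) * heq + τ ^ (2 * k + 2) * (k + 1) * (u τ) ^ 2 * hk

/-- Solutions of the degenerate third Painlevé equation that are meromorphic at the origin
have no pole at the origin: they extend analytically to `τ = 0`. -/
theorem no_pole_at_origin
    (ε b : ℝ) (hε : ε = 1 ∨ ε = -1) (hεb : ε * b > 0) (a : ℂ)
    (U : Set ℂ) (hU : IsOpen U) (h0 : (0 : ℂ) ∈ U)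
    (u : ℂ → ℂ)
    (hu : ∀ τ ∈ U \ {0}, AnalyticAt ℂ u τ)
    (heq : ∀ τ ∈ U \ {0},
      τ * u τ * deriv (deriv u) τ =
        τ * (deriv u τ) ^ 2 - u τ * deriv u τ - 8 * (ε : ℂ) * (u τ) ^ 3 +
          2 * a * (b : ℂ) * u τ + (b : ℂ) ^ 2 * τ)
    (hmero : ∃ N : ℕ, AnalyticAt ℂ (fun τ => τ ^ N * u τ) 0) :
    ∃ g : ℂ → ℂ, AnalyticAt ℂ g 0 ∧ ∀ᶠ τ in nhdsWithin 0 {(0 : ℂ)}ᶜ, g τ = u τ := by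
  have hε0 : (ε : ℂ) ≠ 0 := by
    rcases hε with rfl | rfl <;> simp
  obtain ⟨N, hN⟩ := hmero
  suffices H : ∀ n : ℕ, (∃ g : ℂ → ℂ, AnalyticAt ℂ g 0 ∧
      ∀ᶠ τ in nhdsWithin 0 {(0 : ℂ)}ᶜ, g τ = τ ^ n * u τ) →
      ∃ g : ℂ → ℂ, AnalyticAt ℂ g 0 ∧ ∀ᶠ τ in nhdsWithin 0 {(0 : ℂ)}ᶜ, g τ = u τ from
    H N ⟨_, hN, Eventually.of_forall fun _ => rfl⟩
  intro n
  induction n with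
  | zero => simp
  | succ k ih =>
    rintro ⟨g, hg, hgu⟩
    apply ih
    have hF : ∀ᶠ τ in nhdsWithin 0 {(0 : ℂ)}ᶜ,
        τ ^ (k + 2) * (g τ * deriv (deriv g) τ - (deriv g τ) ^ 2) +
          τ ^ (k + 1) * (g τ * deriv g τ) + 8 * (ε : ℂ) * (g τ) ^ 3 -
          2 * a * b * g τ * τ ^ (2 * k + 2) - (b : ℂ) ^ 2 * τ ^ (3 * k + 4) = 0 := by
      filter_upwards [eventually_eventually_nhdsWithin.2 hgu, self_mem_nhdsWithin,
        mem_nhdsWithin_of_mem_nhds (hU.mem_nhds h0)] with τ hτ hτ0 hτU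
      rw [isOpen_compl_singleton.nhdsWithin_eq hτ0] at hτ
      exact painleve_rescaled (hu τ ⟨hτU, hτ0⟩) hτ (heq τ ⟨hτU, hτ0⟩)
    have hcont : ContinuousAt (fun τ : ℂ =>
        τ ^ (k + 2) * (g τ * deriv (deriv g) τ - (deriv g τ) ^ 2) +
          τ ^ (k + 1) * (g τ * deriv g τ) + 8 * (ε : ℂ) * (g τ) ^ 3 -
          2 * a * b * g τ * τ ^ (2 * k + 2) - (b : ℂ) ^ 2 * τ ^ (3 * k + 4)) 0 := by
      have h1 := hg.continuousAt
      have h2 := hg.deriv.continuousAt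
      have h3 := hg.deriv.deriv.continuousAt
      fun_prop
    have hg0 : g 0 = 0 := by
      have h := tendsto_nhds_unique (hcont.tendsto.mono_left nhdsWithin_le_nhds)
        (tendsto_const_nhds.congr' (hF.mono fun _ h => h.symm))
      simpa [hε0] using h
    obtain ⟨p, hp⟩ := hg
    refine ⟨dslope g 0, ⟨_, hp.has_fpower_series_dslope_fslope⟩, ?_⟩
    filter_upwards [hgu, self_mem_nhdsWithin] with τ hτ hτ0
    have hτ0 : τ ≠ 0 := hτ0
    rw [dslope_of_ne _ hτ0, slope_def_field, hg0, hτ]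
    field_simp
    ring
end

section
/- Let ε = 1 or ε = −1, b ∈ ℝ with εb > 0, a ∈ ℂ, and τ_p ∈ ℂ with τ_p ≠ 0. Let V be an open neighborhood of τ_p with 0 ∉ V, and suppose u : ℂ → ℂ is analytic on V ∖ {τ_p}, satisfies the cleared form of the degenerate third Painlevé equation at every τ ∈ V ∖ {τ_p}, and |u(τ)| → ∞ as τ → τ_p (u has a pole at τ_p). Then there exists a function h analytic on a neighborhood of τ_p such that u(τ) = −ε·τ_p/(4(τ − τ_p)²) + h(τ) for all τ ≠ τ_p near τ_p, and moreover h'(τ_p) = −h(τ_p)/τ_p. In particular, every pole of a solution of the degenerate third Painlevé equation is of second order, with leading Laurent coefficient −ε·τ_p/4. -/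
open Complex Filter

open scoped Topology

/-- A function that is analytic on a punctured neighborhood and tends to infinity is
meromorphic. -/
lemma meromorphicAt_of_tendsto_norm_atTop {u : ℂ → ℂ} {z : ℂ}
    (hu : ∀ᶠ τ in 𝓝[≠] z, AnalyticAt ℂ u τ)
    (hpole : Tendsto (fun τ => ‖u τ‖) (𝓝[≠] z) atTop) : MeromorphicAt u z := by
  have hinv : Tendsto u⁻¹ (𝓝[≠] z) (𝓝 0) :=
    tendsto_inv₀_cobounded.comp (tendsto_norm_atTop_iff_cobounded.mp hpole)
  have heq : Function.update u⁻¹ z 0 =ᶠ[𝓝[≠] z] u⁻¹ := by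
    filter_upwards [self_mem_nhdsWithin] with τ hτ
    exact Function.update_of_ne hτ _ _
  have han : AnalyticAt ℂ (Function.update u⁻¹ z 0) z := by
    refine analyticAt_of_differentiable_on_punctured_nhds_of_continuousAt ?_
      (continuousAt_update_same.mpr hinv)
    filter_upwards [hu, hpole.eventually_gt_atTop 0,
      eventually_nhdsNE_eventually_nhds_iff.mpr heq] with τ hτ hpos hloc
    exact (hτ.inv (norm_pos_iff.mp hpos)).differentiableAt.congr_of_eventuallyEq hloc
  simpa using (han.meromorphicAt.congr heq).inv

/-- A function with a pole has the form `f / (τ - z) ^ n` with `0 < n` and `f z ≠ 0`. -/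
lemma exists_eq_div_pow_of_tendsto_norm_atTop {u : ℂ → ℂ} {z : ℂ}
    (hu : ∀ᶠ τ in 𝓝[≠] z, AnalyticAt ℂ u τ)
    (hpole : Tendsto (fun τ => ‖u τ‖) (𝓝[≠] z) atTop) :
    ∃ n : ℕ, 0 < n ∧ ∃ f : ℂ → ℂ, AnalyticAt ℂ f z ∧ f z ≠ 0 ∧
      u =ᶠ[𝓝[≠] z] fun τ => f τ / (τ - z) ^ n := by
  have hm := meromorphicAt_of_tendsto_norm_atTop hu hpole
  have hneg := (tendsto_cobounded_iff_meromorphicOrderAt_neg hm).mp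
    (tendsto_norm_atTop_iff_cobounded.mp hpole)
  obtain ⟨m, hmo⟩ := WithTop.ne_top_iff_exists.mp (ne_top_of_lt hneg)
  rw [← hmo] at hneg
  have hm0 : m < 0 := by exact_mod_cast hneg
  obtain ⟨f, hf, hfz, hfu⟩ := (meromorphicOrderAt_eq_int_iff hm).mp hmo.symm
  refine ⟨m.natAbs, by omega, f, hf, hfz, ?_⟩
  filter_upwards [hfu] with τ hτ
  have hmn : m = -(m.natAbs : ℤ) := by omega
  rw [hτ, hmn, zpow_neg, zpow_natCast, smul_eq_mul, Int.natAbs_neg, Int.natAbs_natCast,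
    div_eq_inv_mul]

lemma deriv_eventuallyEq_of_eq_div_pow_add {u f g : ℂ → ℂ} {z : ℂ} {n : ℕ}
    (hf : AnalyticAt ℂ f z) (hg : AnalyticAt ℂ g z)
    (hu : u =ᶠ[𝓝[≠] z] fun τ => f τ / (τ - z) ^ n + g τ) :
    deriv u =ᶠ[𝓝[≠] z] fun τ =>
      (deriv f τ * (τ - z) - n * f τ) / (τ - z) ^ (n + 1) + deriv g τ := by
  filter_upwards [hu.nhdsNE_deriv, hf.eventually_analyticAt.filter_mono nhdsWithin_le_nhds,
    hg.eventually_analyticAt.filter_mono nhdsWithin_le_nhds, self_mem_nhdsWithin]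
    with τ hτ hfτ hgτ hne
  have hs : τ - z ≠ 0 := sub_ne_zero.mpr hne
  have hpow : HasDerivAt (fun τ : ℂ => (τ - z) ^ n) (n * (τ - z) ^ (n - 1) * 1) τ :=
    ((hasDerivAt_id τ).sub_const z).pow n
  rw [hτ, ((hfτ.differentiableAt.hasDerivAt.fun_div hpow (pow_ne_zero n hs)).fun_add
    hgτ.differentiableAt.hasDerivAt).deriv]
  congr 1
  cases n with
  | zero => field_simp; simp
  | succ k => field_simp; simp; ring

lemma deriv_deriv_eventuallyEq_of_eq_div_pow_add {u f g : ℂ → ℂ} {z : ℂ} {n : ℕ}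
    (hf : AnalyticAt ℂ f z) (hg : AnalyticAt ℂ g z)
    (hu : u =ᶠ[𝓝[≠] z] fun τ => f τ / (τ - z) ^ n + g τ) :
    deriv (deriv u) =ᶠ[𝓝[≠] z] fun τ =>
      (deriv (deriv f) τ * (τ - z) ^ 2 - 2 * n * deriv f τ * (τ - z) + n * (n + 1) * f τ) /
        (τ - z) ^ (n + 2) + deriv (deriv g) τ := by
  have hsub : AnalyticAt ℂ (fun τ : ℂ => τ - z) z := by fun_prop
  have hnum : AnalyticAt ℂ (fun τ => deriv f τ * (τ - z) - n * f τ) z :=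
    (hf.deriv.mul hsub).sub (analyticAt_const.mul hf)
  filter_upwards [deriv_eventuallyEq_of_eq_div_pow_add hnum hg.deriv
    (deriv_eventuallyEq_of_eq_div_pow_add hf hg hu),
    hf.eventually_analyticAt.filter_mono nhdsWithin_le_nhds] with τ hτ hfτ
  rw [hτ, ((hfτ.deriv.differentiableAt.hasDerivAt.fun_mul
    ((hasDerivAt_id' τ).sub_const z)).fun_sub
    (hfτ.differentiableAt.hasDerivAt.const_mul (n : ℂ))).deriv]
  congr 2
  simp
  ring

/-- A function continuous at `z` vanishes there if a multiple of it by a power of `τ - z`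
vanishes on a punctured neighborhood. -/
lemma ContinuousAt.eq_zero_of_pow_mul_eventually_eq_zero {G : ℂ → ℂ} {z : ℂ}
    (hG : ContinuousAt G z) (k : ℕ) (h : ∀ᶠ τ in 𝓝[≠] z, (τ - z) ^ k * G τ = 0) : G z = 0 := by
  have h0 : G =ᶠ[𝓝[≠] z] fun _ => 0 := by
    filter_upwards [h, self_mem_nhdsWithin] with τ hτ hne
    exact (mul_eq_zero.mp hτ).resolve_left (pow_ne_zero k (sub_ne_zero.mpr hne))
  exact tendsto_nhds_unique (hG.tendsto.mono_left nhdsWithin_le_nhds)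
    (tendsto_const_nhds.congr' h0.symm)

/-- The cleared form of the degenerate third Painlevé equation at the point `τ`. -/
def SatisfiesDegeneratePIII (e a b : ℂ) (u : ℂ → ℂ) (τ : ℂ) : Prop :=
  τ * u τ * deriv (deriv u) τ =
    τ * (deriv u τ) ^ 2 - u τ * deriv u τ - 8 * e * (u τ) ^ 3 + 2 * a * b * u τ + b ^ 2 * τ

namespace SatisfiesDegeneratePIII

variable {e a b z : ℂ} {u f : ℂ → ℂ} {n : ℕ}

/-- The equation for the numerator `f` of `u = f / (τ - z) ^ n`. -/
lemma eventually_numerator_eq (hf : AnalyticAt ℂ f z)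
    (heq : ∀ᶠ τ in 𝓝[≠] z, SatisfiesDegeneratePIII e a b u τ)
    (hu : u =ᶠ[𝓝[≠] z] fun τ => f τ / (τ - z) ^ n) :
    ∀ᶠ τ in 𝓝[≠] z,
      τ * (n * f τ ^ 2 * (τ - z) ^ n +
          (τ - z) ^ (n + 2) * (f τ * deriv (deriv f) τ - deriv f τ ^ 2)) =
        -(f τ * deriv f τ * (τ - z) ^ (n + 2)) + n * f τ ^ 2 * (τ - z) ^ (n + 1) -
          8 * e * (τ - z) ^ 2 * f τ ^ 3 + 2 * a * b * (τ - z) ^ (2 * n + 2) * f τ +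
          b ^ 2 * τ * (τ - z) ^ (3 * n + 2) := by
  have hu0 : u =ᶠ[𝓝[≠] z] fun τ => f τ / (τ - z) ^ n + (fun _ => 0) τ := by simpa using hu
  filter_upwards [heq, hu, deriv_eventuallyEq_of_eq_div_pow_add hf analyticAt_const hu0,
    deriv_deriv_eventuallyEq_of_eq_div_pow_add hf analyticAt_const hu0, self_mem_nhdsWithin]
    with τ h h0 h1 h2 hne
  have hs : τ - z ≠ 0 := sub_ne_zero.mpr hne
  rw [SatisfiesDegeneratePIII, h0, h1, h2] at h
  simp only [deriv_const', add_zero] at h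
  generalize τ - z = s at *
  have hmul := congrArg (fun x => s ^ (3 * n + 2) * x) h
  have hp : s ^ n ≠ 0 := pow_ne_zero n hs
  simp only [pow_add, pow_mul', pow_one] at hmul ⊢
  generalize s ^ n = p at *
  field_simp at hmul
  linear_combination hmul

/-- A pole of a solution away from the origin is of second order. -/
lemma pole_order_eq_two (he : e ≠ 0) (hz : z ≠ 0) (hn : 0 < n)
    (hf : AnalyticAt ℂ f z) (hfz : f z ≠ 0)
    (heq : ∀ᶠ τ in 𝓝[≠] z, SatisfiesDegeneratePIII e a b u τ)
    (hu : u =ᶠ[𝓝[≠] z] fun τ => f τ / (τ - z) ^ n) : n = 2 := by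
  have key := eventually_numerator_eq hf heq hu
  have hc := hf.continuousAt
  have hc1 := hf.deriv.continuousAt
  have hc2 := hf.deriv.deriv.continuousAt
  rcases lt_trichotomy n 2 with h | h | h
  · obtain rfl : n = 1 := by omega
    have := ContinuousAt.eq_zero_of_pow_mul_eventually_eq_zero
      (G := fun τ => τ * (f τ ^ 2 + (τ - z) ^ 2 * (f τ * deriv (deriv f) τ - deriv f τ ^ 2)) +
        f τ * deriv f τ * (τ - z) ^ 2 - f τ ^ 2 * (τ - z) + 8 * e * (τ - z) * f τ ^ 3 -
        2 * a * b * (τ - z) ^ 3 * f τ - b ^ 2 * τ * (τ - z) ^ 4) (z := z) (by fun_prop) 1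
      (by
        filter_upwards [key] with τ hτ
        push_cast at hτ
        linear_combination hτ)
    simp [hz, hfz] at this
  · exact h
  · obtain ⟨k, rfl⟩ : ∃ k, n = k + 3 := ⟨n - 3, by omega⟩
    have := ContinuousAt.eq_zero_of_pow_mul_eventually_eq_zero
      (G := fun τ => τ * ((k + 3) * f τ ^ 2 * (τ - z) ^ (k + 1) +
          (τ - z) ^ (k + 3) * (f τ * deriv (deriv f) τ - deriv f τ ^ 2)) +
        f τ * deriv f τ * (τ - z) ^ (k + 3) - (k + 3) * f τ ^ 2 * (τ - z) ^ (k + 2) +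
        8 * e * f τ ^ 3 - 2 * a * b * (τ - z) ^ (2 * k + 6) * f τ -
        b ^ 2 * τ * (τ - z) ^ (3 * k + 9)) (z := z) (by fun_prop) 2
      (by
        filter_upwards [key] with τ hτ
        push_cast at hτ
        linear_combination hτ)
    simp [he, hfz] at this

/-- The Laurent expansion of a solution at a double pole has no residue term, and its leading
coefficient is determined by the pole. -/
lemma exists_regular_part (he : e ^ 2 = 1) (hf : AnalyticAt ℂ f z) (hfz : f z ≠ 0)
    (heq : ∀ᶠ τ in 𝓝[≠] z, SatisfiesDegeneratePIII e a b u τ)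
    (hu : u =ᶠ[𝓝[≠] z] fun τ => f τ / (τ - z) ^ 2) :
    ∃ h : ℂ → ℂ, AnalyticAt ℂ h z ∧
      u =ᶠ[𝓝[≠] z] fun τ => -e * z / 4 / (τ - z) ^ 2 + h τ := by
  have hf1 := hf.deriv
  have hf2 := hf.deriv.deriv
  refine ⟨fun τ => -e * (τ * (f τ * deriv (deriv f) τ - deriv f τ ^ 2) + f τ * deriv f τ -
    2 * a * b * (τ - z) ^ 2 * f τ - b ^ 2 * τ * (τ - z) ^ 4) / (8 * f τ ^ 2),
    AnalyticAt.fun_div (by fun_prop) (by fun_prop) (by simp [hfz]), ?_⟩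
  filter_upwards [eventually_numerator_eq hf heq hu, hu, self_mem_nhdsWithin,
    (hf.continuousAt.eventually_ne hfz).filter_mono nhdsWithin_le_nhds] with τ hτ huτ hne hfτ
  have hs : τ - z ≠ 0 := sub_ne_zero.mpr hne
  rw [huτ]
  push_cast at hτ
  have hs2 : (τ - z) ^ 2 ≠ 0 := pow_ne_zero 2 hs
  field_simp
  apply mul_left_cancel₀ hs2
  linear_combination 4 * e * hτ - 32 * (τ - z) ^ 2 * f τ ^ 3 * he

/-- The compatibility condition between the first two coefficients of the regular part. -/
lemma deriv_regular_part (he : e ^ 2 = 1) (hz : z ≠ 0) {h : ℂ → ℂ} (hh : AnalyticAt ℂ h z)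
    (heq : ∀ᶠ τ in 𝓝[≠] z, SatisfiesDegeneratePIII e a b u τ)
    (hu : u =ᶠ[𝓝[≠] z] fun τ => -e * z / 4 / (τ - z) ^ 2 + h τ) :
    deriv h z = -h z / z := by
  have hc := hh.continuousAt
  have hc1 := hh.deriv.continuousAt
  have hc2 := hh.deriv.deriv.continuousAt
  have he0 : e ≠ 0 := by rintro rfl; simp at he
  obtain ⟨c, hcz⟩ : ∃ c, c = -e * z / 4 := ⟨_, rfl⟩
  rw [← hcz] at hu
  have hc0 : c ≠ 0 := by simp [hcz, he0, hz]
  have hec : 8 * e * c = -2 * z := by rw [hcz]; linear_combination -2 * z * he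
  have := ContinuousAt.eq_zero_of_pow_mul_eventually_eq_zero
    (G := fun τ => 4 * c * τ * deriv h τ + 4 * c * h τ + (τ - z) *
      (τ * (c * deriv (deriv h) τ + (τ - z) ^ 2 * (h τ * deriv (deriv h) τ - deriv h τ ^ 2)) +
        c * deriv h τ + (τ - z) ^ 2 * h τ * deriv h τ + 8 * e * (3 * c * h τ ^ 2 +
        (τ - z) ^ 2 * h τ ^ 3) - 2 * a * b * (c + (τ - z) ^ 2 * h τ) -
        b ^ 2 * τ * (τ - z) ^ 2)) (z := z) (by fun_prop) 3
    (by
      have hcf : AnalyticAt ℂ (fun _ => c) z := analyticAt_const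
      filter_upwards [heq, hu, deriv_eventuallyEq_of_eq_div_pow_add hcf hh hu,
        deriv_deriv_eventuallyEq_of_eq_div_pow_add hcf hh hu, self_mem_nhdsWithin]
        with τ hτ h0 h1 h2 hne
      obtain ⟨s, rfl⟩ : ∃ s, τ = z + s := ⟨τ - z, by ring⟩
      have hs : s ≠ 0 := by simpa using hne
      rw [SatisfiesDegeneratePIII, h0, h1, h2] at hτ
      simp only [deriv_const', add_sub_cancel_left] at hτ ⊢
      have hmul := congrArg (fun x => s ^ 6 * x) hτ
      push_cast at hmul
      field_simp at hmul
      linear_combination hmul - (c ^ 2 + 3 * c * h (z + s) * s ^ 2) * hec)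
  simp only [sub_self, zero_mul, add_zero] at this
  have h4 : z * deriv h z + h z = 0 := by
    apply mul_left_cancel₀ (mul_ne_zero (by norm_num : (4 : ℂ) ≠ 0) hc0)
    linear_combination this
  rw [eq_div_iff hz]
  linear_combination h4

end SatisfiesDegeneratePIII

/-- Every pole of a solution of the degenerate third Painlevé equation is of second order,
with leading Laurent coefficient `−ε τ_p/4`, and the regular part `h` of the Laurent expansion
satisfies `h'(τ_p) = −h(τ_p)/τ_p` (cf. equation (5.11)). -/
theorem pole_structure
    (ε b : ℝ) (hε : ε = 1 ∨ ε = -1) (hεb : ε * b > 0) (a : ℂ)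
    (τp : ℂ) (hτp : τp ≠ 0)
    (V : Set ℂ) (hV : IsOpen V) (hmem : τp ∈ V) (h0V : (0 : ℂ) ∉ V)
    (u : ℂ → ℂ)
    (hu : ∀ τ ∈ V \ {τp}, AnalyticAt ℂ u τ)
    (heq : ∀ τ ∈ V \ {τp},
      τ * u τ * deriv (deriv u) τ =
        τ * (deriv u τ) ^ 2 - u τ * deriv u τ - 8 * (ε : ℂ) * (u τ) ^ 3 +
          2 * a * (b : ℂ) * u τ + (b : ℂ) ^ 2 * τ)
    (hpole : Tendsto (fun τ => ‖u τ‖) (nhdsWithin τp {τp}ᶜ) atTop) :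
    ∃ h : ℂ → ℂ, AnalyticAt ℂ h τp ∧
      (∀ᶠ τ in nhdsWithin τp {τp}ᶜ,
        u τ = -(ε : ℂ) * τp / (4 * (τ - τp) ^ 2) + h τ) ∧
      deriv h τp = -h τp / τp := by
  have hev : ∀ᶠ τ in 𝓝[≠] τp, τ ∈ V \ {τp} :=
    sdiff_mem_nhdsWithin_compl (hV.mem_nhds hmem) {τp}
  have heq' : ∀ᶠ τ in 𝓝[≠] τp, SatisfiesDegeneratePIII ε a b u τ := hev.mono heq
  have he : (ε : ℂ) ^ 2 = 1 := by rcases hε with rfl | rfl <;> norm_num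
  have he0 : (ε : ℂ) ≠ 0 := by rcases hε with rfl | rfl <;> norm_num
  obtain ⟨n, hn, f, hf, hfz, hfu⟩ :=
    exists_eq_div_pow_of_tendsto_norm_atTop (hev.mono hu) hpole
  obtain rfl := SatisfiesDegeneratePIII.pole_order_eq_two he0 hτp hn hf hfz heq' hfu
  obtain ⟨h, hh, hhu⟩ := SatisfiesDegeneratePIII.exists_regular_part he hf hfz heq' hfu
  refine ⟨h, hh, ?_, SatisfiesDegeneratePIII.deriv_regular_part he hτp hh heq' hhu⟩
  filter_upwards [hhu] with τ hτ
  rw [hτ, div_div]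
end

section
/- Let ε = 1 or ε = −1, b ∈ ℝ with εb > 0, a ∈ ℂ, and τ₀ ∈ ℂ with τ₀ ≠ 0. Let V be an open neighborhood of τ₀ with 0 ∉ V, and suppose u : ℂ → ℂ is analytic on V, satisfies the cleared form of the degenerate third Painlevé equation at every τ ∈ V, and u(τ₀) = 0. Then (u'(τ₀))² = −b² (in particular, since b ≠ 0, the zero τ₀ is of first order and u'(τ₀) = ib or u'(τ₀) = −ib), and furthermore: if u'(τ₀) = ib then u''(τ₀) = −(2a − i)·b/τ₀, while if u'(τ₀) = −ib then u''(τ₀) = −(2a + i)·b/τ₀. -/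
open Complex

/-- Every zero `τ₀ ≠ 0` of a solution of the degenerate third Painlevé equation is of first
order with `u'(τ₀) = ±ib`, and the second derivative at the zero is determined accordingly
(cf. the Taylor expansions (5.12) and (5.13)). -/
theorem zero_structure
    (ε b : ℝ) (hε : ε = 1 ∨ ε = -1) (hεb : ε * b > 0) (a : ℂ)
    (τ₀ : ℂ) (hτ₀ : τ₀ ≠ 0)
    (V : Set ℂ) (hV : IsOpen V) (hmem : τ₀ ∈ V) (h0V : (0 : ℂ) ∉ V)
    (u : ℂ → ℂ)
    (hu : ∀ τ ∈ V, AnalyticAt ℂ u τ)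
    (heq : ∀ τ ∈ V,
      τ * u τ * deriv (deriv u) τ =
        τ * (deriv u τ) ^ 2 - u τ * deriv u τ - 8 * (ε : ℂ) * (u τ) ^ 3 +
          2 * a * (b : ℂ) * u τ + (b : ℂ) ^ 2 * τ)
    (hzero : u τ₀ = 0) :
    (deriv u τ₀) ^ 2 = -(b : ℂ) ^ 2 ∧
    (deriv u τ₀ = I * b → deriv (deriv u) τ₀ = -((2 * a - I) * b / τ₀)) ∧
    (deriv u τ₀ = -(I * b) → deriv (deriv u) τ₀ = -((2 * a + I) * b / τ₀)) := by
  have hA := hu τ₀ hmem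
  have hb : (b : ℂ) ≠ 0 := by
    rintro hb
    rw [ofReal_eq_zero.mp hb, mul_zero] at hεb
    exact lt_irrefl _ hεb
  have hsq : (deriv u τ₀) ^ 2 = -(b : ℂ) ^ 2 := by
    have h := heq τ₀ hmem
    rw [hzero] at h
    apply mul_left_cancel₀ hτ₀
    linear_combination -h
  have d0 : HasDerivAt u (deriv u τ₀) τ₀ := hA.differentiableAt.hasDerivAt
  have d1 : HasDerivAt (deriv u) (deriv (deriv u) τ₀) τ₀ :=
    hA.deriv.differentiableAt.hasDerivAt
  have d2 : HasDerivAt (deriv (deriv u)) (deriv (deriv (deriv u)) τ₀) τ₀ :=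
    hA.deriv.deriv.differentiableAt.hasDerivAt
  have dt := hasDerivAt_id' τ₀
  have hL := (dt.fun_mul d0).fun_mul d2
  have hR := ((((dt.fun_mul (d1.fun_pow 2)).fun_sub (d0.fun_mul d1)).fun_sub
    ((d0.fun_pow 3).const_mul (8 * (ε : ℂ)))).fun_add
    (d0.const_mul (2 * a * (b : ℂ)))).fun_add (dt.const_mul ((b : ℂ) ^ 2))
  have hEq := Filter.eventually_of_mem (hV.mem_nhds hmem) heq
  have key := hL.unique (hR.congr_of_eventuallyEq hEq)
  simp only [hzero] at key
  norm_num at key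
  have hderiv : deriv u τ₀ * (τ₀ * deriv (deriv u) τ₀) =
      deriv u τ₀ * (deriv u τ₀ - 2 * a * b) := by
    linear_combination -key - hsq
  have hne : deriv u τ₀ ≠ 0 := by
    intro h
    rw [h] at hsq
    exact pow_ne_zero 2 hb (by linear_combination hsq)
  have hsecond : deriv (deriv u) τ₀ = (deriv u τ₀ - 2 * a * b) / τ₀ := by
    rw [eq_div_iff hτ₀, mul_comm]
    exact mul_left_cancel₀ hne hderiv
  refine ⟨hsq, fun h => ?_, fun h => ?_⟩ <;>
    · rw [hsecond, h]
      ring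
end

section
/- Let S ⊆ ℂ be open, and for each n ∈ ℤ let w_n : ℂ → ℂ be differentiable on S with w_n(x) ≠ 0 for all x ∈ S. Suppose the family (w_n) satisfies the Volterra lattice equations: for every n ∈ ℤ and x ∈ S, w_n'(x) = w_n(x)·(w_{n+1}(x) − w_{n−1}(x)). Define g_n(x) := w_n(x)·w_{n+1}(x). Then for every n ∈ ℤ and x ∈ S, the second logarithmic derivative of g_n equals the second central difference of the sequence (g_m) with step 2: (d/dx)[g_n'(x)/g_n(x)] = g_{n+2}(x) − 2·g_n(x) + g_{n−2}(x). -/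
open Complex

/-- Along the Volterra chain, the logarithmic derivative of `w_n w_{n+1}` is
`(w_{n+1} − w_{n−1}) + (w_{n+2} − w_n)`. -/
theorem volterra_logDeriv_mul_succ {w : ℤ → ℂ → ℂ} {x : ℂ}
    (hw : ∀ n : ℤ, HasDerivAt (w n) (w n x * (w (n + 1) x - w (n - 1) x)) x)
    (hne : ∀ n : ℤ, w n x ≠ 0) (n : ℤ) :
    deriv (fun y => w n y * w (n + 1) y) x / (w n x * w (n + 1) x) =
      (w (n + 1) x - w (n - 1) x) + (w (n + 2) x - w n x) := by
  have h := ((hw n).fun_mul (hw (n + 1))).deriv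
  rw [h, div_eq_iff (mul_ne_zero (hne n) (hne (n + 1))), show n + 1 + 1 = n + 2 by ring,
    show n + 1 - 1 = n by ring]
  ring

/-- Equation (2.13): if the family `(w_n)_{n ∈ ℤ}` solves the Volterra chain
`w_n' = w_n (w_{n+1} − w_{n−1})` on an open set `S`, then `g_n := w_n w_{n+1}` satisfies
`(d/dx)(g_n'/g_n) = g_{n+2} − 2 g_n + g_{n−2}`. -/
theorem volterra_log_relation
    (S : Set ℂ) (hS : IsOpen S)
    (w : ℤ → ℂ → ℂ)
    (hdiff : ∀ n : ℤ, ∀ x ∈ S, DifferentiableAt ℂ (w n) x)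
    (hne : ∀ n : ℤ, ∀ x ∈ S, w n x ≠ 0)
    (hVolterra : ∀ n : ℤ, ∀ x ∈ S, deriv (w n) x = w n x * (w (n + 1) x - w (n - 1) x))
    (g : ℤ → ℂ → ℂ)
    (hg : ∀ n : ℤ, ∀ x : ℂ, g n x = w n x * w (n + 1) x) :
    ∀ n : ℤ, ∀ x ∈ S,
      deriv (fun y => deriv (g n) y / g n y) x =
        g (n + 2) x - 2 * g n x + g (n - 2) x := by
  intro n x hx
  have hw : ∀ y ∈ S, ∀ m : ℤ, HasDerivAt (w m) (w m y * (w (m + 1) y - w (m - 1) y)) y :=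
    fun y hy m => hVolterra m y hy ▸ (hdiff m y hy).hasDerivAt
  have hlog : (fun y => deriv (g n) y / g n y) =ᶠ[nhds x]
      fun y => (w (n + 1) y - w (n - 1) y) + (w (n + 2) y - w n y) := by
    filter_upwards [hS.mem_nhds hx] with y hy
    rw [show g n = fun z => w n z * w (n + 1) z from funext (hg n)]
    exact volterra_logDeriv_mul_succ (hw y hy) (fun m => hne m y hy) n
  have hderiv := (((hw x hx (n + 1)).fun_sub (hw x hx (n - 1))).fun_add
    ((hw x hx (n + 2)).fun_sub (hw x hx n))).deriv
  rw [hlog.deriv_eq, hderiv, hg, hg, hg, show n + 1 + 1 = n + 2 by ring,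
    show n + 1 - 1 = n by ring, show n - 1 + 1 = n by ring, show n - 1 - 1 = n - 2 by ring,
    show n + 2 - 1 = n + 1 by ring, show n - 2 + 1 = n - 1 by ring]
  ring
end

section
/- Let σ, b₁₁ ∈ ℂ with σ ≠ −2 and b₁₁ ≠ 0, and define A₀ : ℂ → ℂ by A₀(x) = b₁₁·x/(1 + 4b₁₁x/(σ+2)²)². Then for every x ∈ ℂ with x ≠ 0 and 1 + 4b₁₁x/(σ+2)² ≠ 0 (so that A₀(x) ≠ 0), A₀ satisfies the generating-function equation D_x²(ln A₀) = −8A₀ in the logarithmic-derivative form: (2+σ)·x·(d/dx)[ s ↦ (2+σ)·s·A₀'(s)/A₀(s) ](x) = −8·A₀(x), where D_x = (2+σ)·x·d/dx. -/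
open Complex

lemma hasDerivAt_mul_div_one_add_mul_sq (b c : ℂ) {s : ℂ} (hs : 1 + c * s ≠ 0) :
    HasDerivAt (fun x : ℂ => b * x / (1 + c * x) ^ 2) (b * (1 - c * s) / (1 + c * s) ^ 3) s := by
  have h₁ : HasDerivAt (fun x : ℂ => b * x) b s := by
    simpa using (hasDerivAt_id s).const_mul b
  have h₂ : HasDerivAt (fun x : ℂ => 1 + c * x) c s := by
    simpa using ((hasDerivAt_id s).const_mul c).const_add 1
  refine (h₁.fun_div (h₂.fun_pow 2) (pow_ne_zero 2 hs)).congr_deriv ?_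
  field_simp
  ring

lemma hasDerivAt_one_sub_mul_div_one_add_mul (k c : ℂ) {s : ℂ} (hs : 1 + c * s ≠ 0) :
    HasDerivAt (fun x : ℂ => k * ((1 - c * x) / (1 + c * x)))
      (k * (-2 * c / (1 + c * s) ^ 2)) s := by
  have h₁ : HasDerivAt (fun x : ℂ => 1 - c * x) (-c) s := by
    simpa using ((hasDerivAt_id s).const_mul c).const_sub 1
  have h₂ : HasDerivAt (fun x : ℂ => 1 + c * x) c s := by
    simpa using ((hasDerivAt_id s).const_mul c).const_add 1
  refine ((h₁.fun_div h₂ hs).const_mul k).congr_deriv ?_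
  field_simp
  ring

/-- Equation (A.10)/(A.13): the generating function
`A₀(x) = b₁₁ x / (1 + 4 b₁₁ x/(σ+2)²)²` satisfies `D_x²(ln A₀) = −8 A₀`, where
`D_x = (2+σ) x d/dx` and `D_x²(ln A₀)` is interpreted via the logarithmic derivative. -/
theorem generating_function_A0
    (σ b₁₁ : ℂ) (hσ : σ ≠ -2) (hb : b₁₁ ≠ 0)
    (A₀ : ℂ → ℂ)
    (hA₀ : ∀ x : ℂ, A₀ x = b₁₁ * x / (1 + 4 * b₁₁ * x / (σ + 2) ^ 2) ^ 2) :
    ∀ x : ℂ, x ≠ 0 → 1 + 4 * b₁₁ * x / (σ + 2) ^ 2 ≠ 0 →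
      (2 + σ) * x * deriv (fun s => (2 + σ) * s * deriv A₀ s / A₀ s) x = -8 * A₀ x := by
  intro x hx hden
  have hk : 2 + σ ≠ 0 := fun h => hσ (by linear_combination h)
  obtain ⟨c, hc⟩ : ∃ c : ℂ, c = 4 * b₁₁ / (σ + 2) ^ 2 := ⟨_, rfl⟩
  have hcx : ∀ y : ℂ, 4 * b₁₁ * y / (σ + 2) ^ 2 = c * y := fun y => by rw [hc]; ring
  have hck : c * (2 + σ) ^ 2 = 4 * b₁₁ := by
    rw [hc, add_comm σ 2]
    field_simp
  simp only [hcx] at hA₀ hden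
  obtain rfl : A₀ = fun y => b₁₁ * y / (1 + c * y) ^ 2 := funext hA₀
  have hnear : ∀ᶠ s in nhds x, 1 + c * s ≠ 0 :=
    (by fun_prop : Continuous fun s : ℂ => 1 + c * s).continuousAt.eventually_ne hden
  have heq : (fun s => (2 + σ) * s * deriv (fun y => b₁₁ * y / (1 + c * y) ^ 2) s /
      (b₁₁ * s / (1 + c * s) ^ 2)) =ᶠ[nhds x]
      fun s => (2 + σ) * ((1 - c * s) / (1 + c * s)) := by
    filter_upwards [hnear, eventually_ne_nhds hx] with s hs hs0
    rw [(hasDerivAt_mul_div_one_add_mul_sq b₁₁ c hs).deriv]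
    field_simp
  rw [heq.deriv_eq, (hasDerivAt_one_sub_mul_div_one_add_mul (2 + σ) c hden).deriv]
  linear_combination (-2 * x / (1 + c * x) ^ 2) * hck
end
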